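/- There exists an absolute constant c such that the following holds. For N, t, m ∈ ℕ with 0 ≤ t < N and m ≥ 1, let L_m^2 := (1/m) Σ_{i=0}^{|m|−1} 2^i r_i · (K_{2^i}^w ∘ τ_i), and let x ∈ I_N(e_t), the set of y ∈ G with y_t = 1 and y_k = 0 for all k < N with k ≠ t. Then ∫_{I_N} |L_m^2(x+s)| dμ(s) ≤ c · (2^{2t−N} + 2^{N−t} + 2^{|m|−t}) / m. -/

import Mathlib

open MeasureTheory Filter
open scoped ENNReal

noncomputable section

namespace WalshKaczmarz

/-- The Walsh group `G`: sequences of elements of `ZMod 2` with coordinatewise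
addition modulo 2. -/
abbrev G : Type := ℕ → ZMod 2

instance : MeasurableSpace (ZMod 2) := ⊤

/-- The normalized Haar (product) measure on `G`, realized as the pushforward of
Lebesgue measure on `[0,1)` under the binary digit expansion map. Each coordinate
is uniformly distributed on `ZMod 2` and coordinates are independent.  -/
def μG : Measure G :=
  Measure.map (fun t : ℝ => fun k : ℕ => ((⌊t * 2 ^ (k + 1)⌋ : ℤ) : ZMod 2))
    (volume.restrict (Set.Ico (0 : ℝ) 1))

/-- The dyadic interval `I_n(x)`. -/
def I (n : ℕ) (x : G) : Set G := {y : G | ∀ k < n, y k = x k}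

/-- `e n` : the element of `G` whose `n`-th coordinate is `1` and all others `0`. -/
def e (n : ℕ) : G := fun k => if k = n then 1 else 0

/-- The `k`-th Rademacher function `r_k(x) = (-1)^{x_k}`. -/
def rademacher (k : ℕ) (x : G) : ℝ := (-1 : ℝ) ^ (x k).val

/-- `|n| = max {j : n_j ≠ 0}`, the order of `n ≥ 1`. -/
def order (n : ℕ) : ℕ := Nat.log 2 n

/-- The Walsh–Paley function `w_n = ∏_k r_k^{n_k}`. -/
def walsh (n : ℕ) (x : G) : ℝ :=
  ∏ k ∈ Finset.range n, (if n.testBit k then rademacher k x else 1)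

/-- The Walsh–Kaczmarz function `κ_n`. -/
def kacz (n : ℕ) (x : G) : ℝ :=
  if n = 0 then 1 else
    rademacher (order n) x *
      (-1 : ℝ) ^ (∑ k ∈ Finset.range (order n),
        (if n.testBit k then (x (order n - 1 - k)).val else 0))

/-- Skvortsov's coordinate transformation `τ_A`. -/
def tau (A : ℕ) (x : G) : G := fun k => if k < A then x (A - 1 - k) else x k

/-- The Walsh–Paley Dirichlet kernel `D_n^w`. -/
def dirW (n : ℕ) (x : G) : ℝ := ∑ k ∈ Finset.range n, walsh k x

/-- The Walsh–Kaczmarz Dirichlet kernel `D_n^κ`. -/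
def dirK (n : ℕ) (x : G) : ℝ := ∑ k ∈ Finset.range n, kacz k x

/-- The Walsh–Paley Fejér kernel `K_n^w = (1/n) ∑_{k=0}^n D_k^w`. -/
def fejW (n : ℕ) (x : G) : ℝ := (1 / (n : ℝ)) * ∑ k ∈ Finset.range (n + 1), dirW k x

/-- The Walsh–Kaczmarz Fejér kernel `K_n^κ = (1/n) ∑_{k=0}^n D_k^κ`. -/
def fejK (n : ℕ) (x : G) : ℝ := (1 / (n : ℝ)) * ∑ k ∈ Finset.range (n + 1), dirK k x

/-- The Walsh–Kaczmarz–Fourier coefficient of an integrable function. -/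
def coeffK (f : G → ℝ) (k : ℕ) : ℝ := ∫ x, f x * kacz k x ∂μG

/-- The `n`-th Walsh–Kaczmarz partial sum `S_n^κ f`. -/
def SK (f : G → ℝ) (n : ℕ) (x : G) : ℝ := ∑ k ∈ Finset.range n, coeffK f k * kacz k x

/-- The `n`-th Walsh–Kaczmarz Fejér mean `σ_n^κ f = (1/n) ∑_{j=0}^n S_j^κ f`. -/
def sigmaK (f : G → ℝ) (n : ℕ) (x : G) : ℝ :=
  (1 / (n : ℝ)) * ∑ j ∈ Finset.range (n + 1), SK f j x

/-- `𝔉_n` : the σ-algebra generated by the dyadic intervals of measure `2^{-n}`. -/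
def F (n : ℕ) : MeasurableSpace G := MeasurableSpace.generateFrom {s | ∃ x : G, s = I n x}

/-- A martingale with respect to the filtration `(𝔉_n)` of dyadic σ-algebras. -/
def IsDyadicMartingale (f : ℕ → G → ℝ) : Prop :=
  (∀ n, Integrable (f n) μG) ∧ (∀ n, StronglyMeasurable[F n] (f n)) ∧
    ∀ n, μG[f (n + 1)|F n] =ᵐ[μG] f n

/-- `‖f‖_{H_p}^p = ∫ (f^*)^p dμ` for a martingale `f`, where `f^* = sup_n |f^{(n)}|`
is the maximal function. -/
def martHpNormP (p : ℝ) (f : ℕ → G → ℝ) : ℝ≥0∞ :=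
  ∫⁻ x, (⨆ n, ENNReal.ofReal |f n x|) ^ p ∂μG

/-- The martingale Hardy norm `‖f‖_{H_p} = ‖f^*‖_{L_p}`. -/
def martHpNorm (p : ℝ) (f : ℕ → G → ℝ) : ℝ≥0∞ := martHpNormP p f ^ (1 / p)

/-- Membership in the martingale Hardy space `H_p(G)`. -/
def MemHp (p : ℝ) (f : ℕ → G → ℝ) : Prop :=
  IsDyadicMartingale f ∧ martHpNormP p f < ∞

/-- The maximal function of an integrable function `g`, i.e. of the martingale
`(S_{2^n} g)`:  `g^*(x) = sup_n (1/μ(I_n(x))) |∫_{I_n(x)} g dμ|`. -/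
def funMaximal (g : G → ℝ) (x : G) : ℝ≥0∞ :=
  ⨆ n : ℕ, ENNReal.ofReal |∫ u in I n x, g u ∂μG| / μG (I n x)

/-- `‖g‖_{H_p}^p` for a function `g`, identified with the martingale `(S_{2^n} g)`. -/
def funHpNormP (p : ℝ) (g : G → ℝ) : ℝ≥0∞ := ∫⁻ x, funMaximal g x ^ p ∂μG

/-- `‖g‖_{L_p}^p = ∫ |g|^p dμ`. -/
def funLpNormP (p : ℝ) (g : G → ℝ) : ℝ≥0∞ := ∫⁻ x, ENNReal.ofReal |g x| ^ p ∂μG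

/-- The weak `L_p` quasinorm `‖g‖_{L_{p,∞}} = sup_{λ>0} λ μ({|g|>λ})^{1/p}`. -/
def weakLpNorm (p : ℝ) (g : G → ℝ) : ℝ≥0∞ :=
  ⨆ (t : ℝ) (_ : 0 < t), ENNReal.ofReal t * μG {x : G | t < |g x|} ^ (1 / p)

/-- The Walsh–Kaczmarz–Fourier coefficient of a martingale:
`f̂(i) = lim_k ∫ f^{(k)} κ_i dμ`. -/
def martCoeffK (f : ℕ → G → ℝ) (i : ℕ) : ℝ :=
  limUnder atTop (fun k => ∫ x, f k x * kacz i x ∂μG)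

/-- The `n`-th Walsh–Kaczmarz partial sum of a martingale. -/
def martSK (f : ℕ → G → ℝ) (n : ℕ) (x : G) : ℝ :=
  ∑ k ∈ Finset.range n, martCoeffK f k * kacz k x

/-- The `n`-th Walsh–Kaczmarz Fejér mean of a martingale. -/
def martSigmaK (f : ℕ → G → ℝ) (n : ℕ) (x : G) : ℝ :=
  (1 / (n : ℝ)) * ∑ j ∈ Finset.range (n + 1), martSK f j x

/-- A `p`-atom supported on the dyadic interval `I_n(x₀)`. -/
def IsPAtomOn (p : ℝ) (n : ℕ) (x₀ : G) (a : G → ℝ) : Prop :=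
  Measurable a ∧ (∀ y, y ∉ I n x₀ → a y = 0) ∧ (∫ y in I n x₀, a y ∂μG) = 0 ∧
    ∀ y, ENNReal.ofReal |a y| ≤ μG (I n x₀) ^ (-(1 / p))

/-- A `p`-atom. -/
def IsPAtom (p : ℝ) (a : G → ℝ) : Prop := ∃ n x₀, IsPAtomOn p n x₀ a

end WalshKaczmarz
namespace WalshKaczmarz

/-- The kernel `L_m^2 = (1/m) ∑_{i<|m|} 2^i r_i ⋅ (K_{2^i}^w ∘ τ_i)`. -/
def L2 (m : ℕ) (x : G) : ℝ :=
  (1 / (m : ℝ)) *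
    ∑ i ∈ Finset.range (order m), (2 : ℝ) ^ i * rademacher i x * fejW (2 ^ i) (tau i x)

lemma abs_rademacher (k : ℕ) (x : G) : |rademacher k x| = 1 := by
  simp [rademacher, abs_pow]

lemma rademacher_of_eq_one {k : ℕ} {x : G} (h : x k = 1) : rademacher k x = -1 := by
  simp [rademacher, h, ZMod.val_one]

lemma abs_walsh_le (n : ℕ) (x : G) : |walsh n x| ≤ 1 := by
  rw [walsh, Finset.abs_prod]
  refine Finset.prod_le_one (fun _ _ => abs_nonneg _) fun k _ => ?_
  split_ifs
  · exact (abs_rademacher k x).le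
  · simp

lemma walsh_eq_prod_of_lt {n A : ℕ} (h : n < 2 ^ A) (x : G) :
    walsh n x = ∏ k ∈ Finset.range A, (if n.testBit k then rademacher k x else 1) := by
  have key : ∀ B C : ℕ, B ≤ C → n < 2 ^ B →
      ∏ k ∈ Finset.range B, (if n.testBit k then rademacher k x else 1) =
        ∏ k ∈ Finset.range C, (if n.testBit k then rademacher k x else 1) := by
    intro B C hBC hB
    refine Finset.prod_subset (Finset.range_mono hBC) fun k _ hk => ?_
    have hk' : B ≤ k := by simpa using hk
    rw [Nat.testBit_lt_two_pow (hB.trans_le (Nat.pow_le_pow_right two_pos hk'))]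
    simp
  rw [walsh]
  rcases le_total n A with h' | h'
  · exact key n A h' Nat.lt_two_pow_self
  · exact (key A n h' h).symm

lemma walsh_two_pow_add {n k : ℕ} (h : k < 2 ^ n) (x : G) :
    walsh (2 ^ n + k) x = rademacher n x * walsh k x := by
  rw [walsh_eq_prod_of_lt (A := n + 1) (by rw [pow_succ]; omega), walsh_eq_prod_of_lt h,
    Finset.prod_range_succ, Nat.testBit_two_pow_add_eq, Nat.testBit_lt_two_pow h, mul_comm]
  simp only [Bool.not_false, if_true]
  congr 1
  refine Finset.prod_congr rfl fun i hi => ?_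
  rw [Nat.testBit_two_pow_add_gt (Finset.mem_range.1 hi)]

lemma abs_dirW_le (n : ℕ) (x : G) : |dirW n x| ≤ n := by
  rw [dirW]
  refine (Finset.abs_sum_le_sum_abs _ _).trans ?_
  simpa using Finset.sum_le_sum fun k (_ : k ∈ Finset.range n) => abs_walsh_le k x

lemma dirW_two_pow_add {n k : ℕ} (h : k ≤ 2 ^ n) (x : G) :
    dirW (2 ^ n + k) x = dirW (2 ^ n) x + rademacher n x * dirW k x := by
  simp only [dirW]
  rw [Finset.sum_range_add, Finset.mul_sum]
  congr 1
  exact Finset.sum_congr rfl fun i hi =>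
    walsh_two_pow_add ((Finset.mem_range.1 hi).trans_le h) x

lemma dirW_two_pow_succ (n : ℕ) (x : G) :
    dirW (2 ^ (n + 1)) x = (1 + rademacher n x) * dirW (2 ^ n) x := by
  rw [pow_succ, mul_two, dirW_two_pow_add le_rfl]
  ring

/-- `D_{2^n}^w` vanishes off `I_n`. -/
lemma dirW_two_pow_eq_zero {x : G} {j n : ℕ} (hj : x j = 1) (hn : j < n) :
    dirW (2 ^ n) x = 0 := by
  induction n, hn using Nat.le_induction with
  | base => rw [dirW_two_pow_succ, rademacher_of_eq_one hj]; ring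
  | succ n _ ih => rw [dirW_two_pow_succ, ih, mul_zero]

lemma sum_dirW_two_pow_succ (n : ℕ) (x : G) :
    ∑ k ∈ Finset.range (2 ^ (n + 1)), dirW k x =
      (1 + rademacher n x) * ∑ k ∈ Finset.range (2 ^ n), dirW k x +
        2 ^ n * dirW (2 ^ n) x := by
  rw [pow_succ, mul_two, Finset.sum_range_add,
    Finset.sum_congr rfl fun i hi => dirW_two_pow_add (Finset.mem_range.1 hi).le x,
    Finset.sum_add_distrib, ← Finset.mul_sum]
  simp
  ring

lemma abs_sum_dirW_two_pow_le {x : G} {j n : ℕ} (hj : x j = 1) (hn : j < n) :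
    |∑ k ∈ Finset.range (2 ^ n), dirW k x| ≤ 2 ^ (n + j) := by
  induction n, hn using Nat.le_induction with
  | base =>
    rw [sum_dirW_two_pow_succ, rademacher_of_eq_one hj]
    simp only [add_neg_cancel, zero_mul, zero_add, abs_mul, abs_pow, Nat.abs_ofNat]
    have h : |dirW (2 ^ j) x| ≤ 2 ^ j := by simpa using abs_dirW_le (2 ^ j) x
    calc (2 : ℝ) ^ j * |dirW (2 ^ j) x| ≤ 2 ^ j * 2 ^ j := by gcongr
      _ = 2 ^ (j + j) := (pow_add _ _ _).symm
      _ ≤ 2 ^ (j.succ + j) := pow_le_pow_right₀ one_le_two (by omega)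
  | succ n hn ih =>
    rw [sum_dirW_two_pow_succ, dirW_two_pow_eq_zero hj hn, mul_zero, add_zero, abs_mul]
    have h : |1 + rademacher n x| ≤ 2 := by
      refine (abs_add_le _ _).trans ?_
      rw [abs_rademacher]
      norm_num
    calc _ ≤ 2 * (2 : ℝ) ^ (n + j) := by gcongr
      _ = 2 ^ (n + 1 + j) := by ring

lemma sum_dirW_two_pow_eq_zero {x : G} {l j n : ℕ} (hl : x l = 1) (hj : x j = 1) (hlj : l < j)
    (hn : j < n) : ∑ k ∈ Finset.range (2 ^ n), dirW k x = 0 := by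
  induction n, hn using Nat.le_induction with
  | base => rw [sum_dirW_two_pow_succ, rademacher_of_eq_one hj, dirW_two_pow_eq_zero hl hlj]; ring
  | succ n hn ih => rw [sum_dirW_two_pow_succ, ih, dirW_two_pow_eq_zero hj hn]; ring

lemma abs_fejW_two_pow_le (n : ℕ) (x : G) : |fejW (2 ^ n) x| ≤ 2 ^ n := by
  have h : |∑ k ∈ Finset.range (2 ^ n + 1), dirW k x| ≤ 2 ^ n * 2 ^ n := by
    rw [Finset.sum_range_succ']
    simp only [dirW, Finset.range_zero, Finset.sum_empty, add_zero]
    refine (Finset.abs_sum_le_sum_abs _ _).trans ?_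
    calc _ ≤ ∑ k ∈ Finset.range (2 ^ n), (2 : ℝ) ^ n := by
          refine Finset.sum_le_sum fun k hk => (abs_dirW_le (k + 1) x).trans ?_
          exact_mod_cast Finset.mem_range.1 hk
      _ = 2 ^ n * 2 ^ n := by simp
  rw [fejW, abs_mul]
  push_cast
  rw [abs_of_pos (by positivity), one_div, inv_mul_le_iff₀ (by positivity)]
  exact h

lemma abs_fejW_two_pow_le_of_eq_one {x : G} {j n : ℕ} (hj : x j = 1) (hn : j < n) :
    |fejW (2 ^ n) x| ≤ 2 ^ j := by
  rw [fejW, Finset.sum_range_succ, dirW_two_pow_eq_zero hj hn, add_zero, abs_mul]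
  push_cast
  rw [abs_of_pos (by positivity), one_div, inv_mul_le_iff₀ (by positivity), ← pow_add]
  exact abs_sum_dirW_two_pow_le hj hn

lemma fejW_two_pow_eq_zero {x : G} {l j n : ℕ} (hl : x l = 1) (hj : x j = 1) (hlj : l < j)
    (hn : j < n) : fejW (2 ^ n) x = 0 := by
  rw [fejW, Finset.sum_range_succ, dirW_two_pow_eq_zero hj hn,
    sum_dirW_two_pow_eq_zero hl hj hlj hn]
  simp

lemma tau_apply_reflect {i k : ℕ} (h : k < i) (x : G) : tau i x (i - 1 - k) = x k := by
  rw [tau, if_pos (by omega)]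
  congr 1
  omega

lemma measurable_digits :
    Measurable (fun t : ℝ => fun k : ℕ => ((⌊t * 2 ^ (k + 1)⌋ : ℤ) : ZMod 2)) := by
  refine measurable_pi_lambda _ fun k => ?_
  exact (measurable_from_top (f := fun a : ℤ => (a : ZMod 2))).comp
    (Int.measurable_floor.comp (measurable_id.mul_const _))

lemma measurableSet_I (n : ℕ) (x : G) : MeasurableSet (I n x) := by
  have h : I n x = ⋂ k ∈ Set.Iio n, (fun y : G => y k) ⁻¹' {x k} := by
    ext y; simp [I]
  rw [h]
  exact MeasurableSet.biInter (Set.to_countable _) fun k _ =>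
    measurable_pi_apply k (MeasurableSpace.measurableSet_top)

lemma floor_mul_two_pow_eq {s t : ℝ} (hs : s ∈ Set.Ico (0 : ℝ) 1) (ht : t ∈ Set.Ico (0 : ℝ) 1)
    {n : ℕ} (h : ∀ k < n, ((⌊s * 2 ^ (k + 1)⌋ : ℤ) : ZMod 2) = (⌊t * 2 ^ (k + 1)⌋ : ℤ)) :
    ⌊s * 2 ^ n⌋ = ⌊t * 2 ^ n⌋ := by
  induction n with
  | zero =>
    rw [pow_zero, mul_one, mul_one, Int.floor_eq_zero_iff.2 hs, Int.floor_eq_zero_iff.2 ht]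
  | succ n ih =>
    have ih' := ih fun k hk => h k (by omega)
    have hdiv : ∀ a : ℝ, ⌊a * 2 ^ n⌋ = ⌊a * 2 ^ (n + 1)⌋ / 2 := by
      intro a
      have := Int.floor_div_natCast (a * 2 ^ (n + 1)) 2
      rw [← Nat.cast_ofNat (R := ℤ), ← this, pow_succ]
      congr 1
      push_cast
      ring
    have hmod := (ZMod.intCast_eq_intCast_iff' _ _ 2).1 (h n (by omega))
    rw [hdiv, hdiv] at ih'
    push_cast at hmod
    omega

lemma μG_I_le (n : ℕ) (x : G) : μG (I n x) ≤ ENNReal.ofReal ((2 ^ n : ℝ)⁻¹) := by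
  rw [μG, Measure.map_apply measurable_digits (measurableSet_I n x),
    Measure.restrict_apply (measurable_digits (measurableSet_I n x))]
  refine (Real.volume_le_diam _).trans (Metric.ediam_le fun s hs t ht => ?_)
  have h := floor_mul_two_pow_eq hs.2 ht.2 (n := n) fun k hk => (hs.1 k hk).trans (ht.1 k hk).symm
  have h1 := Int.abs_sub_lt_one_of_floor_eq_floor h
  rw [edist_dist, Real.dist_eq]
  refine ENNReal.ofReal_le_ofReal ?_
  rw [← sub_mul, abs_mul, abs_of_pos (a := (2 : ℝ) ^ n) (by positivity)] at h1
  rw [← one_div, le_div_iff₀ (by positivity)]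
  exact h1.le

lemma μG_I_real_le (n : ℕ) (x : G) : μG.real (I n x) ≤ (2 ^ n : ℝ)⁻¹ :=
  ENNReal.toReal_le_of_le_ofReal (by positivity) (μG_I_le n x)

instance : IsFiniteMeasure μG := by
  unfold μG
  infer_instance

/-- The `i`-th summand of `m L_m^2` on `I_N(e_t)` is bounded by a constant, and for `i > N` it is
supported on a coset of `I_i`. -/
lemma abs_L2_summand_le {N t : ℕ} {x s : G} (htN : t < N) (hx : x ∈ I N (e t)) (hs : s ∈ I N 0)
    (i : ℕ) :
    |(2 : ℝ) ^ i * rademacher i (x + s) * fejW (2 ^ i) (tau i (x + s))| ≤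
      (I (max i N) (fun k => if k < N then 0 else x k)).indicator
        (fun _ => (2 : ℝ) ^ i * 2 ^ (if i ≤ t then i else i - t)) s := by
  have hxt : (x + s) t = 1 := by simp [hx t htN, hs t htN, e]
  rw [abs_mul, abs_mul, abs_rademacher, mul_one, abs_of_pos (a := (2 : ℝ) ^ i) (by positivity)]
  by_cases hmem : s ∈ I (max i N) (fun k => if k < N then 0 else x k)
  · rw [Set.indicator_of_mem hmem]
    gcongr
    split_ifs with hit
    · exact abs_fejW_two_pow_le _ _
    · refine (abs_fejW_two_pow_le_of_eq_one
        ((tau_apply_reflect (by omega : t < i) _).trans hxt) (by omega)).trans ?_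
      exact pow_le_pow_right₀ one_le_two (by omega)
  · rw [Set.indicator_of_notMem hmem]
    simp only [I, Set.mem_ofPred_eq, not_forall] at hmem
    obtain ⟨k, hk, hne⟩ := hmem
    have hNk : N ≤ k := by
      by_contra hlt
      exact hne (by rw [if_pos (by omega)]; exact hs k (by omega))
    have hki : k < i := by omega
    rw [if_neg (by omega)] at hne
    have hone : (x + s) k = 1 := by
      have : ∀ a b : ZMod 2, b ≠ a → a + b = 1 := by decide
      exact this _ _ hne
    rw [fejW_two_pow_eq_zero ((tau_apply_reflect hki _).trans hone)
      ((tau_apply_reflect (by omega : t < i) _).trans hxt) (by omega) (by omega)]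
    simp

lemma sum_range_four_pow_le (n : ℕ) : ∑ i ∈ Finset.range (n + 1), (4 : ℝ) ^ i ≤ 2 * 4 ^ n := by
  rw [geom_sum_eq (by norm_num), pow_succ]
  have : (0 : ℝ) < 4 ^ n := by positivity
  linarith

lemma sum_range_ite_four_pow_le (M n : ℕ) :
    ∑ i ∈ Finset.range M, (if i ≤ n then (4 : ℝ) ^ i else 0) ≤ 2 * 4 ^ n := by
  refine le_trans ?_ (sum_range_four_pow_le n)
  rw [← Finset.sum_filter]
  refine Finset.sum_le_sum_of_subset_of_nonneg (fun i hi => ?_) fun _ _ _ => by positivity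
  simp only [Finset.mem_filter, Finset.mem_range] at hi ⊢
  omega

lemma sum_L2_bounds_le {N t : ℕ} (htN : t < N) (M : ℕ) :
    ∑ i ∈ Finset.range M,
        (2 ^ max i N : ℝ)⁻¹ * ((2 : ℝ) ^ i * 2 ^ (if i ≤ t then i else i - t)) ≤
      2 * ((2 : ℝ) ^ (2 * (t : ℤ) - N) + 2 ^ ((N : ℤ) - t) + 2 ^ ((M : ℤ) - t)) := by
  have h2 : (2 : ℝ) ≠ 0 := two_ne_zero
  have hterm : ∀ i : ℕ, (2 ^ max i N : ℝ)⁻¹ * ((2 : ℝ) ^ i * 2 ^ (if i ≤ t then i else i - t)) ≤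
      (if i ≤ t then (4 : ℝ) ^ i else 0) * (2 : ℝ) ^ (-(N : ℤ)) +
        (if i ≤ N then (4 : ℝ) ^ i else 0) * (2 : ℝ) ^ (-(N : ℤ) - t) +
        2 ^ i * (2 : ℝ) ^ (-(t : ℤ)) := by
    intro i
    have h4 : (4 : ℝ) ^ i = 2 ^ (2 * (i : ℤ)) := by
      rw [zpow_mul]; norm_num
    rw [h4, ← zpow_natCast, ← zpow_natCast, ← zpow_natCast, ← zpow_neg, ← zpow_add₀ h2,
      ← zpow_add₀ h2, ← zpow_add₀ h2]
    have hA : (0 : ℝ) ≤ (if i ≤ t then (2 : ℝ) ^ (2 * (i : ℤ)) else 0) * 2 ^ (-(N : ℤ)) := by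
      positivity
    have hB : (0 : ℝ) ≤ (if i ≤ N then (2 : ℝ) ^ (2 * (i : ℤ)) else 0) *
        2 ^ (-(N : ℤ) - t) := by positivity
    have hC : (0 : ℝ) ≤ (2 : ℝ) ^ ((i : ℤ) + -t) := by positivity
    by_cases hit : i ≤ t
    · refine le_trans (le_of_eq ?_) (le_add_of_le_of_nonneg (le_add_of_nonneg_right hB) hC)
      rw [if_pos hit, if_pos hit, ← zpow_add₀ h2]
      congr 1
      rw [max_eq_right (by omega)]
      ring
    · by_cases hiN : i ≤ N
      · refine le_trans (le_of_eq ?_) (le_add_of_le_of_nonneg (le_add_of_nonneg_left hA) hC)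
        rw [if_neg hit, if_pos hiN, ← zpow_add₀ h2]
        congr 1
        rw [max_eq_right hiN]
        push_cast [Nat.le_of_not_le hit]
        ring
      · refine le_trans (le_of_eq ?_) (le_add_of_nonneg_left (add_nonneg hA hB))
        rw [if_neg hit]
        congr 1
        rw [max_eq_left (by omega)]
        push_cast [Nat.le_of_not_le hit]
        ring
  refine (Finset.sum_le_sum fun i _ => hterm i).trans ?_
  rw [Finset.sum_add_distrib, Finset.sum_add_distrib, ← Finset.sum_mul, ← Finset.sum_mul,
    ← Finset.sum_mul, mul_add, mul_add]
  have h4 : ∀ n : ℕ, (4 : ℝ) ^ n = 2 ^ (2 * (n : ℤ)) := by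
    intro n; rw [zpow_mul]; norm_num
  refine add_le_add (add_le_add ?_ ?_) ?_
  · rw [sub_eq_add_neg, zpow_add₀ h2, ← h4, ← mul_assoc]
    gcongr
    exact sum_range_ite_four_pow_le M t
  · have : (2 : ℝ) * 2 ^ ((N : ℤ) - t) = 2 * 4 ^ N * 2 ^ (-(N : ℤ) - t) := by
      rw [h4, mul_assoc, ← zpow_add₀ h2]
      congr 2
      ring
    rw [this]
    gcongr
    exact sum_range_ite_four_pow_le M N
  · rw [sub_eq_add_neg, zpow_add₀ h2, zpow_natCast, ← mul_assoc]
    gcongr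
    rw [geom_sum_eq (by norm_num)]
    have : (0 : ℝ) < 2 ^ M := by positivity
    linarith

/-- There is an absolute constant `c` such that for `0 ≤ t < N`, `m ≥ 1` and
`x ∈ I_N(e_t)`,
`∫_{I_N} |L_m^2(x+s)| dμ(s) ≤ c (2^{2t-N} + 2^{N-t} + 2^{|m|-t}) / m`. -/
theorem L2_integral_bound_et :
    ∃ c : ℝ, ∀ (N t m : ℕ) (x : G), t < N → 1 ≤ m → x ∈ I N (e t) →
      (∫ s in I N 0, |L2 m (x + s)| ∂μG) ≤
        c * ((2 : ℝ) ^ (2 * (t : ℤ) - N) + 2 ^ ((N : ℤ) - t)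
            + 2 ^ ((order m : ℤ) - t)) / m := by
  refine ⟨2, fun N t m x htN _ hx => ?_⟩
  set S : ℕ → Set G := fun i => I (max i N) (fun k => if k < N then 0 else x k)
  set C : ℕ → ℝ := fun i => (2 : ℝ) ^ i * 2 ^ (if i ≤ t then i else i - t)
  have hint : ∀ i, Integrable ((S i).indicator fun _ => C i) (μG.restrict (I N 0)) := fun i =>
    (integrable_const _).indicator (measurableSet_I _ _)
  have hbound : ∀ i, ∫ s in I N 0, (S i).indicator (fun _ => C i) s ∂μG ≤
      (2 ^ max i N : ℝ)⁻¹ * C i := by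
    intro i
    rw [integral_indicator_const _ (measurableSet_I _ _), smul_eq_mul]
    gcongr
    refine le_trans ?_ (μG_I_real_le (max i N) fun k => if k < N then 0 else x k)
    exact ENNReal.toReal_mono (measure_ne_top _ _) (Measure.restrict_apply_le _ _)
  calc ∫ s in I N 0, |L2 m (x + s)| ∂μG
      ≤ ∫ s in I N 0, 1 / (m : ℝ) *
          ∑ i ∈ Finset.range (order m), (S i).indicator (fun _ => C i) s ∂μG := by
        refine integral_mono_of_nonneg (ae_of_all _ fun _ => abs_nonneg _)
          ((integrable_finsetSum _ fun i _ => hint i).const_mul _) ?_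
        filter_upwards [ae_restrict_mem (measurableSet_I N 0)] with s hs
        rw [L2, abs_mul, abs_of_nonneg (a := 1 / (m : ℝ)) (by positivity)]
        gcongr
        exact (Finset.abs_sum_le_sum_abs _ _).trans
          (Finset.sum_le_sum fun i _ => abs_L2_summand_le htN hx hs i)
    _ = 1 / (m : ℝ) * ∑ i ∈ Finset.range (order m),
          ∫ s in I N 0, (S i).indicator (fun _ => C i) s ∂μG := by
        rw [integral_const_mul, integral_finsetSum _ fun i _ => hint i]
    _ ≤ 1 / (m : ℝ) * (2 * ((2 : ℝ) ^ (2 * (t : ℤ) - N) + 2 ^ ((N : ℤ) - t)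
            + 2 ^ ((order m : ℤ) - t))) := by
        gcongr
        exact (Finset.sum_le_sum fun i _ => hbound i).trans (sum_L2_bounds_le htN _)
    _ = _ := by ring

end WalshKaczmarz
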